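/- Let ‖·‖ be a norm on ℝ² whose closed unit ball B contains the closed Euclidean disc E of radius r centered at the origin, and assume E is the ellipse of maximal area contained in B. Then the Lebesgue measure of B satisfies μ(B) ≤ (4/π)·μ(E); equivalently, μ(B) ≤ 4r². -/

import Mathlib

open MeasureTheory Set

lemma affine_integral (A B a b : ℝ) :
    ∫ x in a..b, (A + B * x) = A * (b - a) + B * (b ^ 2 - a ^ 2) / 2 := by
  rw [intervalIntegral.integral_add (by simp) (by apply Continuous.intervalIntegrable; fun_prop)]
  rw [intervalIntegral.integral_const_mul, integral_id, intervalIntegral.integral_const, smul_eq_mul]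
  ring

lemma half_area (r p q : ℝ) (hr : 0 < r) (hp : 0 < p) (hq : 0 < q) (hp1 : p ≤ 1) (hq1 : q ≤ 1)
    (hpq : 1 ≤ p + q + p * q) :
    ∫ x in (-r)..r, min (r * (1 + q ^ 2) / (2 * q) + (1 - q ^ 2) / (2 * q) * x)
      (r * (1 + p ^ 2) / (2 * p) + (-(1 - p ^ 2) / (2 * p)) * x) ≤ 2 * r ^ 2 := by
  set G : ℝ → ℝ := fun x => r * (1 + q ^ 2) / (2 * q) + (1 - q ^ 2) / (2 * q) * x with hG
  set F : ℝ → ℝ := fun x => r * (1 + p ^ 2) / (2 * p) + (-(1 - p ^ 2) / (2 * p)) * x with hF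
  have cG : Continuous G := by fun_prop
  have cF : Continuous F := by fun_prop
  have ck : Continuous (fun x => min (G x) (F x)) := cG.min cF
  set c := r * (q - p) / (p + q) with hc
  have hc1 : -r ≤ c := by
    rw [hc, le_div_iff₀ (by positivity)]; nlinarith [mul_pos hr hq]
  have hc2 : c ≤ r := by
    rw [hc, div_le_iff₀ (by positivity)]; nlinarith [mul_pos hr hp]
  change ∫ x in (-r)..r, min (G x) (F x) ≤ _
  rw [← intervalIntegral.integral_add_adjacent_intervals (b := c)
    (ck.intervalIntegrable _ _) (ck.intervalIntegrable _ _)]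
  have h1 : ∫ x in (-r)..c, min (G x) (F x) ≤ ∫ x in (-r)..c, G x :=
    intervalIntegral.integral_mono_on hc1 (ck.intervalIntegrable _ _) (cG.intervalIntegrable _ _)
      (fun x _ => min_le_left _ _)
  have h2 : ∫ x in c..r, min (G x) (F x) ≤ ∫ x in c..r, F x :=
    intervalIntegral.integral_mono_on hc2 (ck.intervalIntegrable _ _) (cF.intervalIntegrable _ _)
      (fun x _ => min_le_right _ _)
  rw [hG, affine_integral] at h1
  rw [hF, affine_integral] at h2
  refine (add_le_add h1 h2).trans ?_
  have e : r * (1 + q ^ 2) / (2 * q) * (c - -r) + (1 - q ^ 2) / (2 * q) * (c ^ 2 - (-r) ^ 2) / 2 +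
      (r * (1 + p ^ 2) / (2 * p) * (r - c) + -(1 - p ^ 2) / (2 * p) * (r ^ 2 - c ^ 2) / 2)
      = r ^ 2 * (((p + q) ^ 2 + (1 - p * q)) / (p + q)) := by
    rw [hc]; field_simp; ring
  rw [e, mul_comm]
  apply mul_le_mul_of_nonneg_right _ (by positivity)
  rw [div_le_iff₀ (by positivity)]
  have a1 : p + q - 1 ≤ p * q := by nlinarith
  have a2 : p * q ≤ 1 := by nlinarith
  have a3 : 0 < p * q := by positivity
  nlinarith

lemma hex_area_pos (r p q : ℝ) (hr : 0 < r) (hp : 0 < p) (hq : 0 < q) (hp1 : p ≤ 1) (hq1 : q ≤ 1)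
    (hpq : 1 ≤ p + q + p * q) :
    volume {z : ℝ × ℝ | |z.1| ≤ r ∧ |(1 - p ^ 2) * z.1 + 2 * p * z.2| ≤ r * (1 + p ^ 2) ∧
      |-(1 - q ^ 2) * z.1 + 2 * q * z.2| ≤ r * (1 + q ^ 2)} ≤ ENNReal.ofReal (4 * r ^ 2) := by
  have hh := half_area r p q hr hp hq hp1 hq1 hpq
  set k : ℝ → ℝ := fun x => min (r * (1 + q ^ 2) / (2 * q) + (1 - q ^ 2) / (2 * q) * x)
      (r * (1 + p ^ 2) / (2 * p) + (-(1 - p ^ 2) / (2 * p)) * x) with hk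
  have ck : Continuous k := by fun_prop
  have hp2 : p ^ 2 ≤ 1 := by nlinarith
  have hq2 : q ^ 2 ≤ 1 := by nlinarith
  have knn : ∀ x, |x| ≤ r → 0 ≤ k x := by
    intro x hx
    rw [abs_le] at hx
    refine le_min ?_ ?_
    · have : r * (1 + q ^ 2) / (2 * q) + (1 - q ^ 2) / (2 * q) * x =
        (r * (1 + q ^ 2) + (1 - q ^ 2) * x) / (2 * q) := by ring
      rw [this]
      apply div_nonneg _ (by positivity)
      nlinarith
    · have : r * (1 + p ^ 2) / (2 * p) + (-(1 - p ^ 2) / (2 * p)) * x =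
        (r * (1 + p ^ 2) - (1 - p ^ 2) * x) / (2 * p) := by ring
      rw [this]
      apply div_nonneg _ (by positivity)
      nlinarith
  have key : ∀ x y, (1 - p ^ 2) * x + 2 * p * y ≤ r * (1 + p ^ 2) →
      -(1 - q ^ 2) * x + 2 * q * y ≤ r * (1 + q ^ 2) → y ≤ k x := by
    intro x y h1 h2
    refine le_min ?_ ?_
    · have : r * (1 + q ^ 2) / (2 * q) + (1 - q ^ 2) / (2 * q) * x =
        (r * (1 + q ^ 2) + (1 - q ^ 2) * x) / (2 * q) := by ring
      rw [this, le_div_iff₀ (by positivity)]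
      linarith
    · have : r * (1 + p ^ 2) / (2 * p) + (-(1 - p ^ 2) / (2 * p)) * x =
        (r * (1 + p ^ 2) - (1 - p ^ 2) * x) / (2 * p) := by ring
      rw [this, le_div_iff₀ (by positivity)]
      linarith
  have hmeas : MeasurableSet {z : ℝ × ℝ | |z.1| ≤ r ∧
      |(1 - p ^ 2) * z.1 + 2 * p * z.2| ≤ r * (1 + p ^ 2) ∧
      |-(1 - q ^ 2) * z.1 + 2 * q * z.2| ≤ r * (1 + q ^ 2)} := by
    apply IsClosed.measurableSet
    simp only [ofPred_and]
    refine IsClosed.inter ?_ (IsClosed.inter ?_ ?_) <;> apply isClosed_le <;> fun_prop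
  rw [Measure.volume_eq_prod, Measure.prod_apply hmeas]
  calc _ ≤ ∫⁻ x, (Icc (-r) r).indicator (fun x => ENNReal.ofReal (k x + k (-x))) x := by
        apply lintegral_mono
        intro x
        by_cases hx : x ∈ Icc (-r) r
        · simp only [indicator_of_mem hx]
          calc _ ≤ volume (Icc (-k (-x)) (k x)) := by
                apply measure_mono
                rintro y ⟨-, h1, h2⟩
                simp only [abs_le] at h1 h2
                refine ⟨?_, key x y h1.2 h2.2⟩
                have := key (-x) (-y) (by linarith) (by linarith)
                linarith
            _ = _ := by rw [Real.volume_Icc]; congr 1; ring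
        · simp only [indicator_of_notMem hx]
          simp only [nonpos_iff_eq_zero]
          convert measure_empty (μ := (volume : Measure ℝ))
          ext y
          simp only [mem_preimage, mem_ofPred_eq, mem_empty_iff_false, iff_false]
          rintro ⟨h, -⟩
          exact hx (by rw [abs_le] at h; exact h)
    _ = ∫⁻ x in Icc (-r) r, ENNReal.ofReal (k x + k (-x)) := by
        rw [lintegral_indicator measurableSet_Icc]
    _ = ENNReal.ofReal (∫ x in Icc (-r) r, (k x + k (-x))) := by
        rw [ofReal_integral_eq_lintegral_ofReal]
        · apply Continuous.integrableOn_Icc; fun_prop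
        · filter_upwards [ae_restrict_mem measurableSet_Icc] with x hx
          have : |x| ≤ r := abs_le.2 hx
          exact add_nonneg (knn x this) (knn _ (by rwa [abs_neg]))
    _ ≤ _ := by
        apply ENNReal.ofReal_le_ofReal
        rw [integral_Icc_eq_integral_Ioc, ← intervalIntegral.integral_of_le (by linarith),
          intervalIntegral.integral_add (ck.intervalIntegrable _ _)
            (Continuous.intervalIntegrable (by fun_prop) _ _),
          intervalIntegral.integral_comp_neg (f := k), neg_neg]
        linarith

lemma square_area (r : ℝ) (hr : 0 < r) :
    volume {z : ℝ × ℝ | |z.1| ≤ r ∧ |z.2| ≤ r} ≤ ENNReal.ofReal (4 * r ^ 2) := by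
  have : {z : ℝ × ℝ | |z.1| ≤ r ∧ |z.2| ≤ r} = Icc (-r) r ×ˢ Icc (-r) r := by
    ext z; simp only [mem_ofPred_eq, mem_prod, mem_Icc, abs_le]
  rw [this, Measure.volume_eq_prod, Measure.prod_prod, Real.volume_Icc,
    ← ENNReal.ofReal_mul (by linarith)]
  apply ENNReal.ofReal_le_ofReal
  nlinarith

lemma hex_area (r p q : ℝ) (hr : 0 < r) (hp : 0 ≤ p) (hq : 0 ≤ q) (hp1 : p ≤ 1) (hq1 : q ≤ 1)
    (hpq : 1 ≤ p + q + p * q) :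
    volume {z : ℝ × ℝ | |z.1| ≤ r ∧ |(1 - p ^ 2) * z.1 + 2 * p * z.2| ≤ r * (1 + p ^ 2) ∧
      |-(1 - q ^ 2) * z.1 + 2 * q * z.2| ≤ r * (1 + q ^ 2)} ≤ ENNReal.ofReal (4 * r ^ 2) := by
  rcases hp.eq_or_lt with rfl | hp
  · have : q = 1 := by linarith
    subst this
    refine (measure_mono ?_).trans (square_area r hr)
    rintro z ⟨h1, -, h2⟩
    refine ⟨h1, ?_⟩
    simp only [abs_le] at h2 ⊢
    constructor <;> linarith
  rcases hq.eq_or_lt with rfl | hq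
  · have : p = 1 := by linarith
    subst this
    refine (measure_mono ?_).trans (square_area r hr)
    rintro z ⟨h1, h2, -⟩
    refine ⟨h1, ?_⟩
    simp only [abs_le] at h2 ⊢
    constructor <;> linarith
  exact hex_area_pos r p q hr hp hq hp1 hq1 hpq

lemma trig_ge (c s c' s' : ℝ) (hc : 0 ≤ c) (hs : 0 ≤ s) (hc' : 0 ≤ c') (hs' : 0 ≤ s')
    (h : c ^ 2 + s ^ 2 = 1) (h' : c' ^ 2 + s' ^ 2 = 1) (hh : c * c' ≤ s * s') : c' ≤ s := by
  apply le_of_sq_le_sq _ hs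
  have : (c * c') ^ 2 ≤ (s * s') ^ 2 := by gcongr
  nlinarith

/-- The area bound in terms of unit vectors. -/
lemma hex_area_trig (r c s c' s' : ℝ) (hr : 0 < r) (hc : 0 ≤ c) (hs : 0 ≤ s) (hc' : 0 ≤ c')
    (hs' : 0 ≤ s') (h : c ^ 2 + s ^ 2 = 1) (h' : c' ^ 2 + s' ^ 2 = 1) (hh : c * c' ≤ s * s') :
    volume {z : ℝ × ℝ | |z.1| ≤ r ∧ |c * z.1 + s * z.2| ≤ r ∧ |-c' * z.1 + s' * z.2| ≤ r}
      ≤ ENNReal.ofReal (4 * r ^ 2) := by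
  have hs1 : s ≤ 1 := by nlinarith
  have hs1' : s' ≤ 1 := by nlinarith
  have g1 : c' ≤ s := trig_ge c s c' s' hc hs hc' hs' h h' hh
  have g2 : c ≤ s' := trig_ge c' s' c s hc' hs' hc hs h' h (by linarith)
  have g3 : 1 ≤ (s * c' + s' * c) + (s * s' - c * c') := by
    have e : (s * c' + s' * c) ^ 2 + (s * s' - c * c') ^ 2 = 1 := by
      have : (s * c' + s' * c) ^ 2 + (s * s' - c * c') ^ 2 =
        (c ^ 2 + s ^ 2) * (c' ^ 2 + s' ^ 2) := by ring
      rw [this, h, h']; ring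
    have a : 0 ≤ s * c' + s' * c := by positivity
    have b : 0 ≤ s * s' - c * c' := by linarith
    by_contra hcon
    push Not at hcon
    nlinarith [mul_nonneg a b]
  have gen : ∀ c s x y : ℝ, 0 ≤ c → c ^ 2 + s ^ 2 = 1 → |c * x + s * y| ≤ r →
      |(1 - (s / (1 + c)) ^ 2) * x + 2 * (s / (1 + c)) * y| ≤ r * (1 + (s / (1 + c)) ^ 2) := by
    intro c s x y hc h hb
    have h0 : 0 < 1 + c := by linarith
    have hs : s ^ 2 = 1 - c ^ 2 := by linarith
    have e1 : 1 + (s / (1 + c)) ^ 2 = 2 / (1 + c) := by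
      rw [div_pow, hs]; field_simp; ring
    have e2 : 1 - (s / (1 + c)) ^ 2 = 2 / (1 + c) * c := by
      rw [div_pow, hs]; field_simp; ring
    have e3 : 2 / (1 + c) * c * x + 2 * (s / (1 + c)) * y = 2 / (1 + c) * (c * x + s * y) := by
      ring
    rw [e1, e2, e3, abs_mul, abs_of_pos (by positivity : 0 < 2 / (1 + c)), mul_comm r]
    gcongr
  refine (measure_mono ?_).trans (hex_area r (s / (1 + c)) (s' / (1 + c')) hr (by positivity)
    (by positivity) (by rw [div_le_one (by positivity)]; linarith)
    (by rw [div_le_one (by positivity)]; linarith) ?_)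
  · rintro z ⟨h1, h2, h3⟩
    refine ⟨h1, gen c s _ _ hc h h2, ?_⟩
    have := gen c' s' (-z.1) z.2 hc' h' (by convert h3 using 2; ring)
    convert this using 2; ring
  · have : s / (1 + c) + s' / (1 + c') + s / (1 + c) * (s' / (1 + c')) =
      (s * (1 + c') + s' * (1 + c) + s * s') / ((1 + c) * (1 + c')) := by field_simp
    rw [this, le_div_iff₀ (by positivity)]
    nlinarith

lemma nsq (v : EuclideanSpace ℝ (Fin 2)) : ‖v‖ ^ 2 = v 0 ^ 2 + v 1 ^ 2 := by
  simp [EuclideanSpace.norm_sq_eq, Fin.sum_univ_two]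

lemma mat_apply0 (a b c d : ℝ) (v : EuclideanSpace ℝ (Fin 2)) :
    Matrix.toEuclideanLin !![a, b; c, d] v 0 = a * v 0 + b * v 1 := by
  simp [Matrix.toEuclideanLin, Matrix.toLpLin_apply, dotProduct, Fin.sum_univ_two]

lemma mat_apply1 (a b c d : ℝ) (v : EuclideanSpace ℝ (Fin 2)) :
    Matrix.toEuclideanLin !![a, b; c, d] v 1 = c * v 0 + d * v 1 := by
  simp [Matrix.toEuclideanLin, Matrix.toLpLin_apply, dotProduct, Fin.sum_univ_two]

lemma mat_det (a b c d : ℝ) :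
    LinearMap.det (Matrix.toEuclideanLin !![a, b; c, d] :
      EuclideanSpace ℝ (Fin 2) →ₗ[ℝ] EuclideanSpace ℝ (Fin 2)) = a * d - b * c := by
  rw [show LinearMap.det (Matrix.toEuclideanLin !![a, b; c, d] :
      EuclideanSpace ℝ (Fin 2) →ₗ[ℝ] EuclideanSpace ℝ (Fin 2)) = _ from
      LinearMap.det_toLpLin 2 _, Matrix.det_fin_two_of]

lemma N_nonneg (N : EuclideanSpace ℝ (Fin 2) → ℝ)
    (hNsmul : ∀ (a : ℝ) v, N (a • v) = |a| * N v)
    (hNtri : ∀ v w, N (v + w) ≤ N v + N w) (v) : 0 ≤ N v := by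
  have h0 : N 0 = 0 := by simpa using hNsmul 0 0
  have h1 : N (-v) = N v := by simpa using hNsmul (-1) v
  have := hNtri v (-v)
  rw [add_neg_cancel, h0, h1] at this
  linarith

lemma N_le (N : EuclideanSpace ℝ (Fin 2) → ℝ)
    (hNsmul : ∀ (a : ℝ) v, N (a • v) = |a| * N v)
    (r : ℝ) (hr : 0 < r)
    (hsub : Metric.closedBall (0 : EuclideanSpace ℝ (Fin 2)) r ⊆ {v | N v ≤ 1}) (v) :
    r * N v ≤ ‖v‖ := by
  by_cases hv : v = 0
  · subst hv
    have h0 : N 0 = 0 := by simpa using hNsmul 0 0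
    simp [h0]
  have hv' : 0 < ‖v‖ := norm_pos_iff.2 hv
  have : (r / ‖v‖) • v ∈ Metric.closedBall (0 : EuclideanSpace ℝ (Fin 2)) r := by
    rw [mem_closedBall_zero_iff, norm_smul, Real.norm_eq_abs, abs_of_pos (by positivity)]
    field_simp; rfl
  have := hsub this
  simp only [mem_ofPred_eq, hNsmul] at this
  rw [abs_of_pos (by positivity), div_mul_eq_mul_div, div_le_one hv'] at this
  exact this

lemma N_cont (N : EuclideanSpace ℝ (Fin 2) → ℝ)
    (hNsmul : ∀ (a : ℝ) v, N (a • v) = |a| * N v)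
    (hNtri : ∀ v w, N (v + w) ≤ N v + N w)
    (r : ℝ) (hr : 0 < r)
    (hle : ∀ v, r * N v ≤ ‖v‖) : Continuous N := by
  apply LipschitzWith.continuous (K := ⟨r⁻¹, by positivity⟩)
  apply LipschitzWith.of_le_add_mul
  intro x y
  have h1 := hNtri y (x - y)
  have h2 := hle (x - y)
  rw [add_sub_cancel] at h1
  rw [dist_eq_norm]
  have : N (x - y) ≤ r⁻¹ * ‖x - y‖ := by
    rw [inv_mul_eq_div, le_div_iff₀ hr]; linarith
  exact h1.trans (add_le_add_right this (N y))

lemma support (N : EuclideanSpace ℝ (Fin 2) → ℝ)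
    (hNsmul : ∀ (a : ℝ) v, N (a • v) = |a| * N v)
    (hNtri : ∀ v w, N (v + w) ≤ N v + N w)
    (r : ℝ) (hr : 0 < r)
    (hle : ∀ v, r * N v ≤ ‖v‖) (u v : EuclideanSpace ℝ (Fin 2))
    (hu : u 0 ^ 2 + u 1 ^ 2 = 1) (hNu : N (r • u) = 1) (hv : N v ≤ 1) :
    v 0 * u 0 + v 1 * u 1 ≤ r := by
  by_contra hcon
  push Not at hcon
  set t := v 0 * u 0 + v 1 * u 1 with ht
  set d := r * (t - r) with hd
  have hdpos : 0 < d := mul_pos hr (by linarith)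
  set V := v 0 ^ 2 + v 1 ^ 2 with hV
  have hVpos : 0 < V := by
    by_contra h0
    have h0' : v 0 = 0 := by nlinarith [sq_nonneg (v 0), sq_nonneg (v 1)]
    have h1' : v 1 = 0 := by nlinarith [sq_nonneg (v 0), sq_nonneg (v 1)]
    rw [ht, h0', h1'] at hcon
    linarith
  set l := d / (V + d) with hl
  have hl0 : 0 < l := by positivity
  have hl1 : l < 1 := by rw [hl, div_lt_one (by positivity)]; linarith
  have hlV : l * V ≤ d := by
    rw [hl, div_mul_eq_mul_div, div_le_iff₀ (by positivity)]; nlinarith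
  have h1 := hNtri (r • u - l • v) (l • v)
  rw [sub_add_cancel, hNu, hNsmul, abs_of_pos hl0] at h1
  have h2 : ‖r • u - l • v‖ < r * (1 - l) := by
    apply lt_of_pow_lt_pow_left₀ 2 (mul_nonneg hr.le (by linarith))
    rw [nsq]
    simp only [PiLp.sub_apply, PiLp.smul_apply, smul_eq_mul]
    have : (r * u 0 - l * v 0) ^ 2 + (r * u 1 - l * v 1) ^ 2 =
      r ^ 2 * (u 0 ^ 2 + u 1 ^ 2) - 2 * l * r * t + l * (l * V) := by rw [ht, hV]; ring
    rw [this, hu]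
    have h3 : l * (l * V) ≤ l * d := by gcongr
    have h4 : l * r * t = l * d + l * r ^ 2 := by rw [hd]; ring
    nlinarith [mul_pos hl0 hdpos, sq_nonneg (r * l)]
  have h3 := hle (r • u - l • v)
  have h4 : N (r • u - l • v) < 1 - l := by
    have := h3.trans_lt h2
    exact lt_of_mul_lt_mul_left this hr.le
  nlinarith

set_option maxHeartbeats 1000000 in
lemma cone (N : EuclideanSpace ℝ (Fin 2) → ℝ)
    (hN0 : ∀ v, N v = 0 ↔ v = 0)
    (hNsmul : ∀ (a : ℝ) v, N (a • v) = |a| * N v)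
    (hNtri : ∀ v w, N (v + w) ≤ N v + N w)
    (r : ℝ) (hr : 0 < r)
    (hsub : Metric.closedBall (0 : EuclideanSpace ℝ (Fin 2)) r ⊆ {v | N v ≤ 1})
    (hmax : ∀ L : EuclideanSpace ℝ (Fin 2) ≃ₗ[ℝ] EuclideanSpace ℝ (Fin 2),
      (⇑L '' Metric.closedBall 0 1 ⊆ {v | N v ≤ 1}) →
      volume (⇑L '' Metric.closedBall (0 : EuclideanSpace ℝ (Fin 2)) 1) ≤
        volume (Metric.closedBall (0 : EuclideanSpace ℝ (Fin 2)) r))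
    (e f : ℝ) (hef : e ^ 2 + f ^ 2 = 1) :
    ∃ w : EuclideanSpace ℝ (Fin 2), w 0 ^ 2 + w 1 ^ 2 = 1 ∧ N (r • w) = 1 ∧
      (-w 0 * f + w 1 * e) ^ 2 ≤ (w 0 * e + w 1 * f) ^ 2 := by
  by_contra hcon
  push Not at hcon
  have hle := N_le N hNsmul r hr hsub
  have hcont := N_cont N hNsmul hNtri r hr hle
  set K : Set (EuclideanSpace ℝ (Fin 2)) := Metric.sphere 0 1 ∩
    {w | (-w 0 * f + w 1 * e) ^ 2 ≤ (w 0 * e + w 1 * f) ^ 2} with hK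
  have hKc : IsCompact K := (isCompact_sphere _ _).inter_right
    (isClosed_le (by fun_prop) (by fun_prop))
  have hKn : K.Nonempty := by
    refine ⟨!₂[e, f], ?_, ?_⟩
    · rw [mem_sphere_zero_iff_norm, ← sq_eq_sq₀ (norm_nonneg _) (by norm_num), nsq]
      simpa using hef
    · simp only [mem_ofPred_eq]
      have : -(!₂[e, f] : EuclideanSpace ℝ (Fin 2)) 0 * f +
        (!₂[e, f] : EuclideanSpace ℝ (Fin 2)) 1 * e = 0 := by simp; ring
      rw [this, zero_pow two_ne_zero]; exact sq_nonneg _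
  obtain ⟨w, hw, hwmax⟩ := hKc.exists_isMaxOn hKn
    (f := fun w => N (r • w)) (by fun_prop)
  set m := N (r • w) with hm
  have hw1 : ‖w‖ = 1 := by simpa using hw.1
  have hw2 : w 0 ^ 2 + w 1 ^ 2 = 1 := by rw [← nsq, hw1]; norm_num
  have hm1 : m ≤ 1 := by
    have := hle (r • w)
    rw [norm_smul, hw1, Real.norm_eq_abs, abs_of_pos hr, mul_one] at this
    nlinarith
  have hm2 : m ≠ 1 := fun h => absurd hw.2 (not_le.2 (hcon w hw2 h))
  have hmlt : m < 1 := lt_of_le_of_ne hm1 hm2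
  have hm0 : 0 < m := by
    refine lt_of_le_of_ne (N_nonneg N hNsmul hNtri _) (fun h => ?_)
    have := (hN0 _).1 h.symm
    rw [smul_eq_zero] at this
    rcases this with h | h
    · exact hr.ne' h
    · rw [h] at hw1; simp at hw1
  have hK2 : ∀ v : EuclideanSpace ℝ (Fin 2),
      (-v 0 * f + v 1 * e) ^ 2 ≤ (v 0 * e + v 1 * f) ^ 2 → r * N v ≤ m * ‖v‖ := by
    intro v hv
    by_cases hv0 : v = 0
    · subst hv0; rw [(hN0 0).2 rfl]; simp
    have hvp : 0 < ‖v‖ := norm_pos_iff.2 hv0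
    have : ‖v‖⁻¹ • v ∈ K := by
      refine ⟨?_, ?_⟩
      · rw [mem_sphere_zero_iff_norm, norm_smul, norm_inv, norm_norm, inv_mul_cancel₀ hvp.ne']
      · simp only [mem_ofPred_eq, PiLp.smul_apply, smul_eq_mul]
        have e1 : -(‖v‖⁻¹ * v 0) * f + ‖v‖⁻¹ * v 1 * e = ‖v‖⁻¹ * (-v 0 * f + v 1 * e) := by ring
        have e2 : (‖v‖⁻¹ * v 0) * e + ‖v‖⁻¹ * v 1 * f = ‖v‖⁻¹ * (v 0 * e + v 1 * f) := by ring
        rw [e1, e2, mul_pow, mul_pow]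
        gcongr
    have := hwmax this
    simp only [mem_ofPred_eq, hNsmul] at this
    rw [abs_of_pos hr, abs_of_pos (inv_pos.2 hvp)] at this
    have e : r * (‖v‖⁻¹ * N v) = (r * N v) / ‖v‖ := by ring
    rw [e, div_le_iff₀ hvp] at this
    rw [hm, hNsmul, abs_of_pos hr]
    exact this
  set n := Real.sqrt (2 - m ^ 2) with hn
  have hn2 : n ^ 2 = 2 - m ^ 2 := Real.sq_sqrt (by nlinarith)
  have hn0 : 0 < n := Real.sqrt_pos.2 (by nlinarith)
  set a := r / m with ha
  set b := r / n with hb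
  have ham : m * a = r := by rw [ha]; field_simp
  have hbn : n * b = r := by rw [hb]; field_simp
  have ha0 : 0 < a := by positivity
  have hb0 : 0 < b := by positivity
  set T : EuclideanSpace ℝ (Fin 2) →ₗ[ℝ] EuclideanSpace ℝ (Fin 2) := Matrix.toEuclideanLin
    !![a * e ^ 2 + b * f ^ 2, (a - b) * e * f; (a - b) * e * f, a * f ^ 2 + b * e ^ 2] with hT
  have hdet : LinearMap.det T = a * b := by
    rw [hT, mat_det]
    have : (a * e ^ 2 + b * f ^ 2) * (a * f ^ 2 + b * e ^ 2) - (a - b) * e * f * ((a - b) * e * f)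
      = a * b * (e ^ 2 + f ^ 2) ^ 2 := by ring
    rw [this, hef]; ring
  have hdet0 : LinearMap.det T ≠ 0 := by rw [hdet]; positivity
  have hTL : ⇑(LinearMap.equivOfDetNeZero T hdet0) = ⇑T := rfl
  have := hmax (LinearMap.equivOfDetNeZero T hdet0) ?_
  · rw [hTL, Measure.addHaar_image_linearMap, hdet, EuclideanSpace.volume_closedBall_fin_two,
      EuclideanSpace.volume_closedBall_fin_two, abs_of_pos (by positivity),
      ← ENNReal.ofReal_pow hr.le, ← ENNReal.ofReal_pow (by norm_num), one_pow, 
      ← ENNReal.ofReal_mul (by norm_num), ← ENNReal.ofReal_mul (by positivity),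
      ← ENNReal.ofReal_mul (by positivity), one_mul, ENNReal.ofReal_le_ofReal_iff
        (by positivity)] at this
    have h1 := le_of_mul_le_mul_right this Real.pi_pos
    have h2 : m * n < 1 := by
      apply lt_of_pow_lt_pow_left₀ 2 (by norm_num)
      rw [mul_pow, hn2]
      have : m ^ 2 < 1 := by nlinarith
      nlinarith [sq_pos_of_pos (sub_pos.2 this)]
    have h3 : r ^ 2 = (m * n) * (a * b) := by
      calc r ^ 2 = (m * a) * (n * b) := by rw [ham, hbn]; ring
        _ = _ := by ring
    have h4 : 0 < a * b := by positivity
    nlinarith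
  · rw [hTL]
    rintro _ ⟨v, hv, rfl⟩
    rw [mem_closedBall_zero_iff] at hv
    have hv2 : v 0 ^ 2 + v 1 ^ 2 ≤ 1 := by rw [← nsq]; nlinarith [norm_nonneg v]
    have hX : T v 0 * e + T v 1 * f = a * (v 0 * e + v 1 * f) := by
      rw [hT, mat_apply0, mat_apply1]
      linear_combination (a * (v 0 * e + v 1 * f)) * hef
    have hY : -T v 0 * f + T v 1 * e = b * (-v 0 * f + v 1 * e) := by
      rw [hT, mat_apply0, mat_apply1]
      linear_combination (b * (-v 0 * f + v 1 * e)) * hef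
    have hnorm : ‖T v‖ ^ 2 = (T v 0 * e + T v 1 * f) ^ 2 + (-T v 0 * f + T v 1 * e) ^ 2 := by
      rw [nsq]
      linear_combination (-(T v 0 ^ 2 + T v 1 ^ 2)) * hef
    set X := T v 0 * e + T v 1 * f with hXd
    set Y := -T v 0 * f + T v 1 * e with hYd
    have hXY : m ^ 2 * X ^ 2 + (2 - m ^ 2) * Y ^ 2 ≤ r ^ 2 := by
      rw [hX, hY, ← hn2]
      have : m ^ 2 * (a * (v 0 * e + v 1 * f)) ^ 2 + n ^ 2 * (b * (-v 0 * f + v 1 * e)) ^ 2 =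
        (m * a) ^ 2 * (v 0 * e + v 1 * f) ^ 2 + (n * b) ^ 2 * (-v 0 * f + v 1 * e) ^ 2 := by ring
      rw [this, ham, hbn]
      have e2 : r ^ 2 * (v 0 * e + v 1 * f) ^ 2 + r ^ 2 * (-v 0 * f + v 1 * e) ^ 2
        = r ^ 2 * (v 0 ^ 2 + v 1 ^ 2) := by
        linear_combination (r ^ 2 * (v 0 ^ 2 + v 1 ^ 2)) * hef
      rw [e2]
      exact mul_le_of_le_one_right (sq_nonneg r) hv2
    have hmsq : m ^ 2 < 1 := by nlinarith
    rcases le_total (Y ^ 2) (X ^ 2) with h | h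
    · have h1 := hK2 (T v) h
      have h2 : m * ‖T v‖ ≤ r := by
        apply le_of_sq_le_sq _ hr.le
        rw [mul_pow, hnorm]
        clear_value X Y m
        nlinarith only [sq_nonneg Y, hXY, hmsq, mul_nonneg (sub_nonneg.2 hmsq.le) (sq_nonneg Y)]
      have h3 : r * N (T v) ≤ r * 1 := by linarith
      exact le_of_mul_le_mul_left h3 hr
    · apply hsub
      rw [mem_closedBall_zero_iff]
      apply le_of_sq_le_sq _ hr.le
      rw [hnorm]
      clear_value X Y m
      nlinarith only [hXY, mul_nonneg (sub_nonneg.2 hmsq.le) (sub_nonneg.2 h)]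

lemma arc (c s c' s' x y : ℝ) (hc : 0 ≤ c) (hs : 0 ≤ s) (hc' : 0 ≤ c') (hs' : 0 ≤ s')
    (h : c ^ 2 + s ^ 2 = 1) (h' : c' ^ 2 + s' ^ 2 = 1) (hh : s * s' < c * c')
    (hx : c ≤ x) (hy : 0 ≤ y) (hxy : x ^ 2 + y ^ 2 = 1) :
    ((s' - s) * x + (c + c') * y) ^ 2 < (-(c + c') * x + (s' - s) * y) ^ 2 := by
  have hys : y ≤ s := by
    apply le_of_sq_le_sq _ hs
    nlinarith
  have g2 : s' ≤ c := trig_ge s c s' c' hs hc hs' hc' (by linarith) (by linarith) hh.le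
  have g1 : s ≤ c' := trig_ge s' c' s c hs' hc' hs hc (by linarith) (by linarith) (by linarith)
  have hcpos : 0 < c := by
    rcases hc.eq_or_lt with h0 | h0
    · rw [← h0] at hh; nlinarith [mul_nonneg hs hs']
    · exact h0
  have hcpos' : 0 < c' := by
    rcases hc'.eq_or_lt with h0 | h0
    · rw [← h0] at hh; nlinarith [mul_nonneg hs hs']
    · exact h0
  have hA : 0 < c + c' + s' - s := by linarith
  have hA' : 0 < c + c' + s - s' := by linarith
  have k1 : s * (c + c' + s' - s) < c * (c + c' + s - s') := by
    have : s * c' + c * s' ≤ 1 := by nlinarith [sq_nonneg (s - c'), sq_nonneg (c - s')]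
    nlinarith
  have k2 : y * (c + c' + s' - s) < x * (c + c' + s - s') :=
    calc y * (c + c' + s' - s) ≤ s * (c + c' + s' - s) := by gcongr
      _ < c * (c + c' + s - s') := k1
      _ ≤ x * (c + c' + s - s') := by gcongr
  have k3 : 0 < x * (c + c' + s' - s) + y * (c + c' + s - s') := by
    have : 0 < x := by linarith
    positivity
  nlinarith [mul_pos (sub_pos.2 k2) k3]

lemma contacts (N : EuclideanSpace ℝ (Fin 2) → ℝ)
    (hN0 : ∀ v, N v = 0 ↔ v = 0)
    (hNsmul : ∀ (a : ℝ) v, N (a • v) = |a| * N v)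
    (hNtri : ∀ v w, N (v + w) ≤ N v + N w)
    (r : ℝ) (hr : 0 < r)
    (hsub : Metric.closedBall (0 : EuclideanSpace ℝ (Fin 2)) r ⊆ {v | N v ≤ 1})
    (hmax : ∀ L : EuclideanSpace ℝ (Fin 2) ≃ₗ[ℝ] EuclideanSpace ℝ (Fin 2),
      (⇑L '' Metric.closedBall 0 1 ⊆ {v | N v ≤ 1}) →
      volume (⇑L '' Metric.closedBall (0 : EuclideanSpace ℝ (Fin 2)) 1) ≤
        volume (Metric.closedBall (0 : EuclideanSpace ℝ (Fin 2)) r)) :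
    ∃ g h c s c' s' : ℝ, g ^ 2 + h ^ 2 = 1 ∧ 0 ≤ c ∧ 0 ≤ s ∧ 0 ≤ c' ∧ 0 ≤ s' ∧
      c ^ 2 + s ^ 2 = 1 ∧ c' ^ 2 + s' ^ 2 = 1 ∧ c * c' ≤ s * s' ∧
      ∀ v : EuclideanSpace ℝ (Fin 2), N v ≤ 1 →
        |g * v 0 + h * v 1| ≤ r ∧
        |c * (g * v 0 + h * v 1) + s * (-h * v 0 + g * v 1)| ≤ r ∧
        |-c' * (g * v 0 + h * v 1) + s' * (-h * v 0 + g * v 1)| ≤ r := by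
  have hle := N_le N hNsmul r hr hsub
  have hcont := N_cont N hNsmul hNtri r hr hle
  have hcone := cone N hN0 hNsmul hNtri r hr hsub hmax
  have hNneg : ∀ v, N (-v) = N v := fun v => by simpa using hNsmul (-1) v
  have hsup : ∀ u v : EuclideanSpace ℝ (Fin 2), u 0 ^ 2 + u 1 ^ 2 = 1 → N (r • u) = 1 → N v ≤ 1 →
      |v 0 * u 0 + v 1 * u 1| ≤ r := by
    intro u v h1 h2 h3
    have a1 := support N hNsmul hNtri r hr hle u v h1 h2 h3
    have a2 := support N hNsmul hNtri r hr hle u (-v) h1 h2 (by rwa [hNneg])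
    simp only [PiLp.neg_apply] at a2
    rw [abs_le]; constructor <;> linarith
  obtain ⟨u, hu, hNu, -⟩ := hcone 1 0 (by norm_num)
  set g := u 0 with hg
  set h := u 1 with hh
  set C : Set (EuclideanSpace ℝ (Fin 2)) := Metric.sphere 0 1 ∩ {w | N (r • w) = 1} with hC
  have hCc : IsCompact C := (isCompact_sphere _ _).inter_right
    (isClosed_eq (by fun_prop) (by fun_prop))
  have hCmem : ∀ w, w ∈ C ↔ w 0 ^ 2 + w 1 ^ 2 = 1 ∧ N (r • w) = 1 := by
    intro w
    rw [← nsq, hC, mem_inter_iff, mem_sphere_zero_iff_norm, pow_eq_one_iff_of_nonneg (norm_nonneg w) two_ne_zero]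
    rfl
  have hA : IsCompact (C ∩ {w | 0 ≤ w 0 * g + w 1 * h ∧ 0 ≤ -w 0 * h + w 1 * g}) := by
    apply hCc.inter_right
    simp only [ofPred_and]
    refine IsClosed.inter ?_ ?_ <;> apply isClosed_le <;> fun_prop
  have hB : IsCompact (C ∩ {w | w 0 * g + w 1 * h ≤ 0 ∧ 0 ≤ -w 0 * h + w 1 * g}) := by
    apply hCc.inter_right
    simp only [ofPred_and]
    refine IsClosed.inter ?_ ?_ <;> apply isClosed_le <;> fun_prop
  obtain ⟨w₁, ⟨hw₁C, hw₁x, hw₁y⟩, hmin⟩ := hA.exists_isMinOn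
    ⟨u, (hCmem u).2 ⟨hu, hNu⟩, by rw [← hg, ← hh]; nlinarith, by
      rw [← hg, ← hh]; linarith⟩
    (f := fun w => w 0 * g + w 1 * h) (by fun_prop)
  obtain ⟨w₂, ⟨hw₂C, hw₂x, hw₂y⟩, hmax2⟩ := hB.exists_isMaxOn
    ⟨-u, (hCmem (-u)).2 ⟨by simpa using hu, by rwa [smul_neg, hNneg]⟩, by
      simp only [PiLp.neg_apply]; rw [← hg, ← hh]; nlinarith, by
      simp only [PiLp.neg_apply]; rw [← hg, ← hh]; linarith⟩
    (f := fun w => w 0 * g + w 1 * h) (by fun_prop)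
  rw [hCmem] at hw₁C hw₂C
  have frame : ∀ w : EuclideanSpace ℝ (Fin 2), w 0 ^ 2 + w 1 ^ 2 = 1 →
      (w 0 * g + w 1 * h) ^ 2 + (-w 0 * h + w 1 * g) ^ 2 = 1 := by
    intro w hw
    linear_combination (w 0 ^ 2 + w 1 ^ 2) * hu + hw
  have f1 := frame w₁ hw₁C.1
  have f2 := frame w₂ hw₂C.1
  have hlast1 : ∀ v : EuclideanSpace ℝ (Fin 2), (w₁ 0 * g + w₁ 1 * h) * (g * v 0 + h * v 1) +
      (-w₁ 0 * h + w₁ 1 * g) * (-h * v 0 + g * v 1) = v 0 * w₁ 0 + v 1 * w₁ 1 := by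
    intro v
    linear_combination (v 0 * w₁ 0 + v 1 * w₁ 1) * hu
  have hlast2 : ∀ v : EuclideanSpace ℝ (Fin 2), -(-(w₂ 0 * g + w₂ 1 * h)) * (g * v 0 + h * v 1) +
      (-w₂ 0 * h + w₂ 1 * g) * (-h * v 0 + g * v 1) = v 0 * w₂ 0 + v 1 * w₂ 1 := by
    intro v
    linear_combination (v 0 * w₂ 0 + v 1 * w₂ 1) * hu
  refine ⟨g, h, w₁ 0 * g + w₁ 1 * h, -w₁ 0 * h + w₁ 1 * g, -(w₂ 0 * g + w₂ 1 * h),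
    -w₂ 0 * h + w₂ 1 * g, hu, hw₁x, hw₁y, by linarith, hw₂y, f1, by rw [neg_sq]; exact f2, ?_, ?_⟩
  · by_contra hcon
    push Not at hcon
    set c := w₁ 0 * g + w₁ 1 * h with hc
    set s := -w₁ 0 * h + w₁ 1 * g with hs
    set c' := -(w₂ 0 * g + w₂ 1 * h) with hc'
    set s' := -w₂ 0 * h + w₂ 1 * g with hs'
    have hc'0 : 0 ≤ c' := by linarith
    have f2' : c' ^ 2 + s' ^ 2 = 1 := by rw [hc', neg_sq]; exact f2
    have hcc : 0 < c + c' := by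
      by_contra h0
      have e1 : c = 0 := by linarith
      rw [e1] at hcon
      nlinarith [mul_nonneg hw₁y hw₂y]
    have key : ∀ w : EuclideanSpace ℝ (Fin 2), w 0 ^ 2 + w 1 ^ 2 = 1 → N (r • w) = 1 →
        0 ≤ -w 0 * h + w 1 * g →
        ((s' - s) * (w 0 * g + w 1 * h) + (c + c') * (-w 0 * h + w 1 * g)) ^ 2 <
        (-(c + c') * (w 0 * g + w 1 * h) + (s' - s) * (-w 0 * h + w 1 * g)) ^ 2 := by
      intro w hw hNw hy
      rcases le_total 0 (w 0 * g + w 1 * h) with hx | hx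
      · have hcx : c ≤ w 0 * g + w 1 * h := hmin ⟨(hCmem w).2 ⟨hw, hNw⟩, hx, hy⟩
        exact arc c s c' s' _ _ hw₁x hw₁y hc'0 hw₂y f1 f2' hcon hcx hy (frame w hw)
      · have hcx : w 0 * g + w 1 * h ≤ w₂ 0 * g + w₂ 1 * h :=
          hmax2 ⟨(hCmem w).2 ⟨hw, hNw⟩, hx, hy⟩
        have := arc c' s' c s (-(w 0 * g + w 1 * h)) _ hc'0 hw₂y hw₁x hw₁y f2' f1
          (by linarith) (by linarith) hy (by rw [neg_sq]; exact frame w hw)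
        convert this using 1 <;> ring
    set ρ := Real.sqrt ((s' - s) ^ 2 + (c + c') ^ 2) with hρ
    have hρpos : 0 < ρ := Real.sqrt_pos.2 (by positivity)
    have hρ2 : ρ ^ 2 = (s' - s) ^ 2 + (c + c') ^ 2 := Real.sq_sqrt (by positivity)
    obtain ⟨w, hw, hNw, hww⟩ := hcone (((s' - s) * g - (c + c') * h) / ρ)
      (((s' - s) * h + (c + c') * g) / ρ) (by
        rw [div_pow, div_pow, ← add_div, div_eq_one_iff_eq (by positivity), hρ2]
        linear_combination ((s' - s) ^ 2 + (c + c') ^ 2) * hu)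
    have e1 : -w 0 * (((s' - s) * h + (c + c') * g) / ρ) +
        w 1 * (((s' - s) * g - (c + c') * h) / ρ) =
        (-(c + c') * (w 0 * g + w 1 * h) + (s' - s) * (-w 0 * h + w 1 * g)) / ρ := by ring
    have e2 : w 0 * (((s' - s) * g - (c + c') * h) / ρ) +
        w 1 * (((s' - s) * h + (c + c') * g) / ρ) =
        ((s' - s) * (w 0 * g + w 1 * h) + (c + c') * (-w 0 * h + w 1 * g)) / ρ := by ring
    rw [e1, e2, div_pow, div_pow, div_le_div_iff_of_pos_right (by positivity)] at hww
    rcases le_total 0 (-w 0 * h + w 1 * g) with hy | hy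
    · exact absurd hww (not_le.2 (key w hw hNw hy))
    · have := key (-w) (by simpa using hw) (by rwa [smul_neg, hNneg])
        (by simp only [PiLp.neg_apply]; linarith)
      simp only [PiLp.neg_apply] at this
      exact absurd hww (not_le.2 (by linarith))
  · intro v hv
    refine ⟨?_, ?_, ?_⟩
    · have := hsup u v hu hNu hv
      rw [← hg, ← hh] at this
      convert this using 2; ring
    · rw [hlast1]; exact hsup w₁ v hw₁C.1 hw₁C.2 hv
    · rw [hlast2]; exact hsup w₂ v hw₂C.1 hw₂C.2 hv

/-- John's theorem in the plane, round case: if the John ellipse (maximal-area inscribed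
ellipse) of the unit ball `B` of a norm on `ℝ²` is the round disc `E` of radius `r`, then
`μ(B) ≤ (4/π)·μ(E) = 4r²`. Ellipses are images of the Euclidean unit disc under invertible
linear maps. -/
theorem john_round_area_bound
    (N : EuclideanSpace ℝ (Fin 2) → ℝ)
    (hN0 : ∀ v, N v = 0 ↔ v = 0)
    (hNsmul : ∀ (a : ℝ) v, N (a • v) = |a| * N v)
    (hNtri : ∀ v w, N (v + w) ≤ N v + N w)
    (r : ℝ) (hr : 0 < r)
    (hsub : Metric.closedBall (0 : EuclideanSpace ℝ (Fin 2)) r ⊆ {v | N v ≤ 1})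
    (hmax : ∀ L : EuclideanSpace ℝ (Fin 2) ≃ₗ[ℝ] EuclideanSpace ℝ (Fin 2),
      (⇑L '' Metric.closedBall 0 1 ⊆ {v | N v ≤ 1}) →
      volume (⇑L '' Metric.closedBall (0 : EuclideanSpace ℝ (Fin 2)) 1) ≤
        volume (Metric.closedBall (0 : EuclideanSpace ℝ (Fin 2)) r)) :
    volume {v | N v ≤ 1} ≤ ENNReal.ofReal (4 / Real.pi) *
      volume (Metric.closedBall (0 : EuclideanSpace ℝ (Fin 2)) r) ∧
    volume {v | N v ≤ 1} ≤ ENNReal.ofReal (4 * r ^ 2) := by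
  have main : volume {v | N v ≤ 1} ≤ ENNReal.ofReal (4 * r ^ 2) := by
    obtain ⟨g, h, c, s, c', s', hgh, hc, hs, hc', hs', h1, h2, h3, hv⟩ :=
      contacts N hN0 hNsmul hNtri r hr hsub hmax
    refine le_trans ?_ (hex_area_trig r c s c' s' hr hc hs hc' hs' h1 h2 h3)
    set H := {z : ℝ × ℝ | |z.1| ≤ r ∧ |c * z.1 + s * z.2| ≤ r ∧ |-c' * z.1 + s' * z.2| ≤ r} with hH
    have hmeas : MeasurableSet H := by
      apply IsClosed.measurableSet
      simp only [hH, ofPred_and]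
      refine IsClosed.inter ?_ (IsClosed.inter ?_ ?_) <;> apply isClosed_le <;> fun_prop
    have mp := (volume_preserving_finTwoArrow ℝ).comp
      (EuclideanSpace.volume_preserving_symm_measurableEquiv_toLp (Fin 2))
    rw [← mp.measure_preimage hmeas.nullMeasurableSet]
    set R : EuclideanSpace ℝ (Fin 2) →ₗ[ℝ] EuclideanSpace ℝ (Fin 2) :=
      Matrix.toEuclideanLin !![g, h; -h, g] with hR
    have hdet : LinearMap.det R = 1 := by rw [hR, mat_det]; linarith
    have hp := Measure.addHaar_preimage_linearMap (volume : Measure (EuclideanSpace ℝ (Fin 2)))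
      (f := R) (by rw [hdet]; norm_num)
      ((⇑MeasurableEquiv.finTwoArrow ∘ ⇑(MeasurableEquiv.toLp 2 (Fin 2 → ℝ)).symm) ⁻¹' H)
    rw [hdet] at hp
    simp only [inv_one, abs_one, ENNReal.ofReal_one, one_mul] at hp
    rw [← hp]
    apply measure_mono
    intro v hvN
    have := hv v hvN
    change |R v 0| ≤ r ∧ |c * R v 0 + s * R v 1| ≤ r ∧ |-c' * R v 0 + s' * R v 1| ≤ r
    rw [hR, mat_apply0, mat_apply1]
    exact this
  refine ⟨main.trans (le_of_eq ?_), main⟩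
  rw [EuclideanSpace.volume_closedBall_fin_two, ← ENNReal.ofReal_pow hr.le,
    ← ENNReal.ofReal_mul (by positivity), ← ENNReal.ofReal_mul (by positivity)]
  congr 1
  have := Real.pi_pos
  field_simp
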